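/- Let Q(X) ← ⊗_{i=1..m} R_i(X_i) be a sum-product query over a commutative semiring K and let (T, χ) be a tree decomposition of Q, together with a choice function assigning to each atom i a node cover(i) of T with X_i ⊆ χ(cover(i)). For each node v of T, let Y^v = χ(v), let Z^v = χ(v) ∩ χ(parent(v)) for non-root v and Z^{root} = X, and let R_i^v be the K-relation over X_i ∩ Y^v defined by R_i^v = the restriction of R_i (i.e., R_i itself) if cover(i) = v, and otherwise R_i^v(z) = 1 if there exists x ∈ supp(R_i) with x[X_i ∩ Y^v] = z and R_i^v(z) = 0 otherwise. Define recursively, bottom-up over T, the sub-query Q^v(Z^v) ← ⊗_{i=1..m} R_i^v(X_i ∩ Y^v) ⊗ ⊗_{w ∈ child(v)} M^w(Z^w), where M^w = ⟦Q^w⟧ is the K-relation over Z^w computed at child w. Then ⟦Q^{root(T)}⟧ = ⟦Q⟧. -/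

import Mathlib

open scoped Classical

noncomputable section

/-- Closed ancestors in the rooted tree given by the parent function `par`. -/
def anccP {ν : Type*} (par : ν → ν) (v : ν) : Set ν := {u | ∃ n : ℕ, par^[n] v = u}

end

noncomputable section

namespace MessagePassing

section SumOut

variable {V dom K : Type*} [CommSemiring K]

lemma dependsOn_prod {ι : Type*} {s : Finset ι} {C : ι → Set V} {f : ι → (V → dom) → K}
    (hf : ∀ i ∈ s, DependsOn (f i) (C i)) : DependsOn (∏ i ∈ s, f i) (⋃ i ∈ s, C i) := by
  intro w₁ w₂ h
  simp only [Finset.prod_apply]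
  exact Finset.prod_congr rfl fun i hi => hf i hi fun A hA => h A (Set.mem_biUnion hi hA)

variable [Fintype V]

/-- The tuples that agree with `w` outside `S` and take values in `D` on `S`. -/
def box (D : Finset dom) (S : Set V) (w : V → dom) : Finset (V → dom) :=
  Fintype.piFinset fun A => if A ∈ S then D else {w A}

/-- Eliminate the variables in `S` from `f` by summing over their values in `D`. -/
def sumOut (D : Finset dom) (S : Set V) (f : (V → dom) → K) (w : V → dom) : K :=
  ∑ w' ∈ box D S w, f w'

lemma mem_box {D : Finset dom} {S : Set V} {w w' : V → dom} :
    w' ∈ box D S w ↔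
      (∀ A ∈ S, w' A ∈ D) ∧ ∀ A ∉ S, w' A = w A := by
  rw [box, Fintype.mem_piFinset]
  constructor
  · intro h
    refine ⟨fun A hA => ?_, fun A hA => ?_⟩
    · simpa [hA] using h A
    · simpa [hA] using h A
  · rintro ⟨h₁, h₂⟩ A
    by_cases hA : A ∈ S
    · simpa [hA] using h₁ A hA
    · simpa [hA] using h₂ A hA

lemma sumOut_empty (D : Finset dom) (f : (V → dom) → K) : sumOut D ∅ f = f := by
  funext w
  simp [sumOut, box]

lemma sumOut_mul_left {D : Finset dom} {S C : Set V} {f : (V → dom) → K} (hf : DependsOn f C)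
    (hCS : Disjoint C S) (g : (V → dom) → K) : f * sumOut D S g = sumOut D S (f * g) := by
  funext w
  simp only [Pi.mul_apply, sumOut, Finset.mul_sum]
  refine Finset.sum_congr rfl fun w' hw' => ?_
  congr 1
  exact hf fun A hA => ((mem_box.1 hw').2 A (Set.disjoint_left.1 hCS hA)).symm

lemma sumOut_sumOut {D : Finset dom} {S T : Set V} (hST : Disjoint S T) (f : (V → dom) → K) :
    sumOut D S (sumOut D T f) = sumOut D (S ∪ T) f := by
  funext w
  simp only [sumOut]
  rw [← Finset.sum_fiberwise_of_maps_to
    (s := box D (S ∪ T) w) (t := box D S w) (g := fun w' A => if A ∈ T then w A else w' A)]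
  · refine Finset.sum_congr rfl fun w' hw' => Finset.sum_congr ?_ fun _ _ => rfl
    ext w''
    rw [Finset.mem_filter, mem_box, mem_box, funext_iff]
    rw [mem_box] at hw'
    have := Set.disjoint_left.1 hST
    grind
  · intro w' hw'
    rw [mem_box] at hw' ⊢
    have := Set.disjoint_left.1 hST
    grind

lemma dependsOn_sumOut {D : Finset dom} {S C : Set V} {f : (V → dom) → K} (hf : DependsOn f C) :
    DependsOn (sumOut D S f) (C \ S) := by
  intro w₁ w₂ h
  refine Finset.sum_bij' (fun w' _ A => if A ∈ S then w' A else w₂ A)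
    (fun w' _ A => if A ∈ S then w' A else w₁ A) ?_ ?_ ?_ ?_ ?_
  · intro w' hw'
    rw [mem_box] at hw' ⊢
    grind
  · intro w' hw'
    rw [mem_box] at hw' ⊢
    grind
  · intro w' hw'
    rw [mem_box] at hw'
    funext A
    grind
  · intro w' hw'
    rw [mem_box] at hw'
    funext A
    grind
  · intro w' hw'
    rw [mem_box] at hw'
    refine hf fun A hA => ?_
    have := h A
    grind

lemma sumOut_mul_sumOut {D : Finset dom} {S T C C' : Set V} {f g : (V → dom) → K}
    (hf : DependsOn f C) (hg : DependsOn g C') (hST : Disjoint S T) (hCT : Disjoint C T)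
    (hCS : Disjoint C' S) :
    sumOut D S f * sumOut D T g = sumOut D (S ∪ T) (f * g) := by
  rw [mul_comm, sumOut_mul_left (dependsOn_sumOut hg) (hCS.mono_left Set.sdiff_subset),
    mul_comm, sumOut_mul_left hf hCT, sumOut_sumOut hST]

lemma prod_sumOut {ι : Type*} {D : Finset dom} (s : Finset ι) {S C : ι → Set V}
    {f : ι → (V → dom) → K} (hf : ∀ i ∈ s, DependsOn (f i) (C i)) (hSC : ∀ i ∈ s, S i ⊆ C i)
    (hdisj : ∀ i ∈ s, ∀ j ∈ s, i ≠ j → Disjoint (C i) (S j)) :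
    ∏ i ∈ s, sumOut D (S i) (f i) = sumOut D (⋃ i ∈ s, S i) (∏ i ∈ s, f i) := by
  induction s using Finset.induction_on with
  | empty => simp [sumOut_empty]
  | insert a s ha ih =>
    have hne : ∀ i ∈ s, a ≠ i := fun i hi h => ha (h ▸ hi)
    rw [Finset.prod_insert ha, Finset.prod_insert ha,
      ih (fun i hi => hf i (Finset.mem_insert_of_mem hi))
        (fun i hi => hSC i (Finset.mem_insert_of_mem hi))
        (fun i hi j hj => hdisj i (Finset.mem_insert_of_mem hi) j (Finset.mem_insert_of_mem hj)),
      sumOut_mul_sumOut (hf a (Finset.mem_insert_self a s))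
        (dependsOn_prod fun i hi => hf i (Finset.mem_insert_of_mem hi)),
      Finset.set_biUnion_insert]
    · simp only [Set.disjoint_iUnion_right]
      exact fun i hi => (hdisj a (Finset.mem_insert_self a s) i (Finset.mem_insert_of_mem hi)
        (hne i hi)).mono_left (hSC a (Finset.mem_insert_self a s))
    · simp only [Set.disjoint_iUnion_right]
      exact fun i hi => hdisj a (Finset.mem_insert_self a s) i (Finset.mem_insert_of_mem hi)
        (hne i hi)
    · simp only [Set.disjoint_iUnion_left]
      exact fun i hi => hdisj i (Finset.mem_insert_of_mem hi) a (Finset.mem_insert_self a s)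
        (hne i hi).symm

/-- A sum over the tuples on `C`, padded by `dflt` and agreeing with `u` on `Z`, is a finite
elimination of `C \ Z`. -/
lemma finsum_eq_sumOut {D : Finset dom} {C Z : Set V} {f : (V → dom) → K} (hf : DependsOn f C)
    (hD : ∀ w, f w ≠ 0 → ∀ A ∈ C, w A ∈ D) (hZ : Z ⊆ C) (dflt : dom) (u : V → dom) :
    ∑ᶠ w ∈ {w : V → dom | (∀ A, A ∉ C → w A = dflt) ∧ ∀ A ∈ Z, w A = u A}, f w =
      sumOut D (C \ Z) f u := by
  rw [sumOut, ← finsum_mem_coe_finset,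
    finsum_mem_inter_support_eq f (t := {w : V → dom | ((∀ A, A ∉ C → w A = dflt) ∧
      ∀ A ∈ Z, w A = u A) ∧ ∀ A ∈ C \ Z, w A ∈ D})]
  · refine finsum_mem_eq_of_bijOn (fun w A => if A ∈ C then w A else u A) ⟨?_, ?_, ?_⟩ ?_
    · rintro w ⟨⟨h₁, h₂⟩, h₃⟩
      rw [Finset.mem_coe, mem_box]
      grind
    · rintro w ⟨⟨h₁, h₂⟩, h₃⟩ w' ⟨⟨h₁', h₂'⟩, h₃'⟩ h
      funext A
      have := congrFun h A
      grind
    · intro w hw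
      rw [Finset.mem_coe, mem_box] at hw
      refine ⟨fun A => if A ∈ C then w A else dflt, ⟨⟨?_, ?_⟩, ?_⟩, ?_⟩
      · grind
      · intro A hA
        have := hZ hA
        grind
      · grind
      · funext A
        grind
    · intro w _
      exact hf fun A hA => by simp [hA]
  · ext w
    constructor
    · rintro ⟨h, hw⟩
      exact ⟨⟨h, fun A hA => hD w hw A hA.1⟩, hw⟩
    · rintro ⟨h, hw⟩
      exact ⟨h.1, hw⟩

end SumOut

section Tree

variable {ν : Type*} {par : ν → ν} {root : ν}

lemma self_mem_anccP (v : ν) : v ∈ anccP par v := ⟨0, rfl⟩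

lemma par_mem_anccP (v : ν) : par v ∈ anccP par v := ⟨1, rfl⟩

lemma anccP_trans {x y z : ν} (hxy : y ∈ anccP par x) (hyz : z ∈ anccP par y) :
    z ∈ anccP par x := by
  obtain ⟨a, rfl⟩ := hxy
  obtain ⟨b, rfl⟩ := hyz
  exact ⟨b + a, Function.iterate_add_apply par b a x⟩

lemma anccP_total {x y z : ν} (hy : y ∈ anccP par x) (hz : z ∈ anccP par x) :
    z ∈ anccP par y ∨ y ∈ anccP par z := by
  obtain ⟨a, rfl⟩ := hy
  obtain ⟨b, rfl⟩ := hz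
  rcases le_total a b with h | h
  · exact Or.inl ⟨b - a, by rw [← Function.iterate_add_apply, Nat.sub_add_cancel h]⟩
  · exact Or.inr ⟨a - b, by rw [← Function.iterate_add_apply, Nat.sub_add_cancel h]⟩

lemma eq_or_mem_anccP_par {x y : ν} (h : y ∈ anccP par x) : y = x ∨ y ∈ anccP par (par x) := by
  obtain ⟨_ | n, rfl⟩ := h
  · exact Or.inl rfl
  · exact Or.inr ⟨n, (Function.iterate_succ_apply par n x).symm⟩

lemma mem_anccP_iff_exists_child {v x : ν} :
    v ∈ anccP par x ↔ x = v ∨ ∃ c, (par c = v ∧ c ≠ v) ∧ c ∈ anccP par x := by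
  constructor
  · intro h
    by_cases hx : x = v
    · exact Or.inl hx
    · right
      have h₀ : Nat.find h ≠ 0 := fun h₀ => hx (by simpa [h₀] using Nat.find_spec h)
      obtain ⟨k, hk⟩ := Nat.exists_eq_succ_of_ne_zero h₀
      refine ⟨par^[k] x, ⟨?_, ?_⟩, k, rfl⟩
      · rw [← Function.iterate_succ_apply' par k x, ← hk]
        exact Nat.find_spec h
      · exact Nat.find_min h (by omega)
  · rintro (rfl | ⟨c, ⟨rfl, -⟩, hc⟩)
    · exact self_mem_anccP x
    · exact anccP_trans hc (par_mem_anccP c)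

lemma child_notMem_anccP (hT : par root = root ∧ ∀ v : ν, ∃ n : ℕ, par^[n] v = root) {v c : ν}
    (hc : par c = v) (hne : c ≠ v) : c ∉ anccP par v := by
  rintro ⟨a, ha⟩
  have hper : par^[a + 1] v = v := by rw [Function.iterate_succ_apply', ha, hc]
  obtain ⟨n, hn⟩ := hT.2 v
  have hroot : v = root := by
    have h₁ : par^[(a + 1) * n] v = v := by
      rw [Function.iterate_mul, Function.iterate_fixed hper]
    have h₂ : par^[a * n + n] v = root := by
      rw [Function.iterate_add_apply, hn, Function.iterate_fixed hT.1]
    rw [← h₁, ← h₂, Nat.succ_mul]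
  subst hroot
  rw [Function.iterate_fixed hT.1] at ha
  exact hne ha.symm

lemma children_disjoint (hT : par root = root ∧ ∀ v : ν, ∃ n : ℕ, par^[n] v = root)
    {v c c' x : ν} (hc : par c = v ∧ c ≠ v) (hc' : par c' = v ∧ c' ≠ v)
    (hx : c ∈ anccP par x) (hx' : c' ∈ anccP par x) : c = c' := by
  by_contra hne
  rcases anccP_total hx hx' with h | h
  · rcases eq_or_mem_anccP_par h with h | h
    · exact hne h.symm
    · exact child_notMem_anccP hT hc'.1 hc'.2 (hc.1 ▸ h)
  · rcases eq_or_mem_anccP_par h with h | h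
    · exact hne h
    · exact child_notMem_anccP hT hc.1 hc.2 (hc'.1 ▸ h)

end Tree

section Decomposition

variable {V dom K ν : Type*} [CommSemiring K] {root : ν} {par : ν → ν} {χ : ν → Set V}

/-- The running intersection property of a rooted decomposition. -/
def RunningIntersection (par : ν → ν) (χ : ν → Set V) : Prop :=
  ∀ (A : V) (v w : ν), A ∈ χ v → A ∈ χ w →
      ∃ t : ν, A ∈ χ t ∧ t ∈ anccP par v ∧ t ∈ anccP par w ∧
        (∀ u : ν, u ∈ anccP par v → t ∈ anccP par u → A ∈ χ u) ∧
        (∀ u : ν, u ∈ anccP par w → t ∈ anccP par u → A ∈ χ u)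

/-- The interface of `v`: the output variables at the root, and the variables shared with the
parent elsewhere. -/
def interfaceVars (root : ν) (par : ν → ν) (χ : ν → Set V) (Xout : Set V) (v : ν) : Set V :=
  if v = root then Xout else χ v ∩ χ (par v)

lemma interfaceVars_subset {Xout : Set V} (hX : Xout ⊆ χ root) (v : ν) :
    interfaceVars root par χ Xout v ⊆ χ v := by
  rw [interfaceVars]
  split_ifs with h
  · exact h ▸ hX
  · exact Set.inter_subset_left

variable [Fintype ν]

/-- The nodes of the subtree rooted at `v`. -/
def subtree (par : ν → ν) (v : ν) : Finset ν := {x | v ∈ anccP par x}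

/-- The children of `v`. -/
def children (par : ν → ν) (v : ν) : Finset ν := {c | par c = v ∧ c ≠ v}

lemma mem_subtree {v x : ν} : x ∈ subtree par v ↔ v ∈ anccP par x := by simp [subtree]

lemma mem_children {v c : ν} : c ∈ children par v ↔ par c = v ∧ c ≠ v := by simp [children]

lemma subtree_eq (v : ν) :
    subtree par v = insert v ((children par v).biUnion (subtree par)) := by
  ext x
  simp only [mem_subtree, Finset.mem_insert, Finset.mem_biUnion, mem_children]
  exact mem_anccP_iff_exists_child

lemma notMem_biUnion_subtree (hT : par root = root ∧ ∀ v : ν, ∃ n : ℕ, par^[n] v = root) (v : ν) :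
    v ∉ (children par v).biUnion (subtree par) := by
  simp only [Finset.mem_biUnion, mem_children, mem_subtree, not_exists, not_and]
  exact fun c hc => child_notMem_anccP hT hc.1 hc.2

lemma prod_subtree (hT : par root = root ∧ ∀ v : ν, ∃ n : ℕ, par^[n] v = root) {β : Type*}
    [CommMonoid β] (F : ν → β) (v : ν) :
    ∏ x ∈ subtree par v, F x = F v * ∏ c ∈ children par v, ∏ x ∈ subtree par c, F x := by
  rw [subtree_eq, Finset.prod_insert (notMem_biUnion_subtree hT v), Finset.prod_biUnion]
  intro c hc c' hc' hne
  rw [Function.onFun, Finset.disjoint_left]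
  intro x hx hx'
  exact hne (children_disjoint hT (mem_children.1 hc) (mem_children.1 hc') (mem_subtree.1 hx)
    (mem_subtree.1 hx'))

lemma card_subtree_lt (hT : par root = root ∧ ∀ v : ν, ∃ n : ℕ, par^[n] v = root) {v c : ν}
    (hc : c ∈ children par v) : (subtree par c).card < (subtree par v).card := by
  refine Finset.card_lt_card ((Finset.ssubset_iff_of_subset fun x hx => ?_).2 ⟨v, ?_, fun hv => ?_⟩)
  · rw [subtree_eq v]
    exact Finset.mem_insert_of_mem (Finset.mem_biUnion.2 ⟨c, hc, hx⟩)
  · exact mem_subtree.2 (self_mem_anccP v)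
  · exact child_notMem_anccP hT (mem_children.1 hc).1 (mem_children.1 hc).2 (mem_subtree.1 hv)

/-- The variables occurring in the bags of the subtree rooted at `v`. -/
def subtreeVars (par : ν → ν) (χ : ν → Set V) (v : ν) : Set V := ⋃ x ∈ subtree par v, χ x

lemma mem_subtreeVars {v : ν} {A : V} :
    A ∈ subtreeVars par χ v ↔ ∃ x, v ∈ anccP par x ∧ A ∈ χ x := by
  simp [subtreeVars, mem_subtree]

lemma mem_bag_of_mem_subtreeVars (hTD : RunningIntersection par χ) {v c : ν} {A : V}
    (hc : par c = v) (hA : A ∈ subtreeVars par χ c) (hv : A ∈ χ v) : A ∈ χ c := by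
  obtain ⟨x, hx, hAx⟩ := mem_subtreeVars.1 hA
  obtain ⟨t, -, -, ht, h, -⟩ := hTD A x v hAx hv
  exact h c hx (anccP_trans (hc ▸ par_mem_anccP c) ht)

lemma mem_bag_of_mem_two_children (hT : par root = root ∧ ∀ v : ν, ∃ n : ℕ, par^[n] v = root)
    (hTD : RunningIntersection par χ) {v c c' : ν} {A : V} (hc : c ∈ children par v)
    (hc' : c' ∈ children par v) (hne : c ≠ c') (hA : A ∈ subtreeVars par χ c)
    (hA' : A ∈ subtreeVars par χ c') : A ∈ χ v := by
  rw [mem_children] at hc hc'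
  obtain ⟨x, hx, hAx⟩ := mem_subtreeVars.1 hA
  obtain ⟨x', hx', hAx'⟩ := mem_subtreeVars.1 hA'
  obtain ⟨t, -, htx, htx', h, -⟩ := hTD A x x' hAx hAx'
  refine h v (anccP_trans hx (hc.1 ▸ par_mem_anccP c)) ?_
  rcases anccP_total hx htx with h | h
  · rcases eq_or_mem_anccP_par h with h | h
    · subst h
      exact absurd (children_disjoint hT hc hc' htx' hx') hne
    · exact hc.1 ▸ h
  · exact absurd (children_disjoint hT hc hc' (anccP_trans htx' h) hx') hne

lemma interfaceVars_child (hroot : par root = root) {Xout : Set V} {v c : ν}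
    (hc : c ∈ children par v) : interfaceVars root par χ Xout c = χ c ∩ χ v := by
  obtain ⟨rfl, hne⟩ := mem_children.1 hc
  rw [interfaceVars, if_neg]
  rintro rfl
  exact hne hroot.symm

lemma subtreeVars_eq (v : ν) :
    subtreeVars par χ v = χ v ∪ ⋃ c ∈ children par v, subtreeVars par χ c := by
  simp only [subtreeVars]
  rw [subtree_eq v, Finset.set_biUnion_insert, Finset.set_biUnion_biUnion]

/-- Bottom-up message passing eliminates exactly the non-interface variables of each subtree. -/
theorem message_eq_sumOut [Fintype V]
    (hT : par root = root ∧ ∀ v : ν, ∃ n : ℕ, par^[n] v = root)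
    (hTD : RunningIntersection par χ) {Xout : Set V} (hX : Xout ⊆ χ root) {D : Finset dom}
    {F M : ν → (V → dom) → K} (hF : ∀ v, DependsOn (F v) (χ v))
    (hM : ∀ v, M v = sumOut D (χ v \ interfaceVars root par χ Xout v)
      (F v * ∏ c ∈ children par v, M c)) (v : ν) :
    M v = sumOut D (subtreeVars par χ v \ interfaceVars root par χ Xout v)
      (∏ x ∈ subtree par v, F x) := by
  induction hn : (subtree par v).card using Nat.strong_induction_on generalizing v with
  | _ n ih =>
  subst hn
  have hchild : ∀ c ∈ children par v,
      M c = sumOut D (subtreeVars par χ c \ χ v) (∏ x ∈ subtree par c, F x) := by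
    intro c hc
    rw [ih _ (card_subtree_lt hT hc) c rfl, interfaceVars_child hT.1 hc]
    congr 1
    ext A
    have := mem_bag_of_mem_subtreeVars hTD (A := A) (mem_children.1 hc).1
    grind
  rw [hM v, Finset.prod_congr rfl hchild,
    prod_sumOut (C := subtreeVars par χ) _ (fun c _ => dependsOn_prod fun x _ => hF x)
      (fun c _ => Set.sdiff_subset),
    sumOut_mul_left (hF v), sumOut_sumOut, ← prod_subtree hT F v]
  · congr 1
    rw [subtreeVars_eq v]
    have := interfaceVars_subset (par := par) hX v
    ext A
    have := @this A
    simp only [Set.mem_union, Set.mem_sdiff, Set.mem_iUnion, exists_prop]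
    grind
  · simp only [Set.disjoint_iUnion_right]
    exact fun c _ => Set.disjoint_sdiff_right.mono_left Set.sdiff_subset
  · simp only [Set.disjoint_iUnion_right]
    exact fun c _ => Set.disjoint_sdiff_right
  · intro c hc c' hc' hne
    rw [Set.disjoint_left]
    exact fun A hA hA' => hA'.2 (mem_bag_of_mem_two_children hT hTD hc hc' hne hA hA'.1)

end Decomposition

section Atoms

variable {V dom K : Type*} [CommSemiring K]

/-- All values occurring in the supports of finitely many finitely supported relations lie in a
common finite set. -/
lemma exists_activeDomain [Finite V] (dflt : dom) {ι : Type*} [Finite ι] {X : ι → Set V}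
    {R : ι → (V → dom) → K} (hdep : ∀ i, DependsOn (R i) (X i))
    (hfin : ∀ i, {v : V → dom | R i v ≠ 0 ∧ ∀ A, A ∉ X i → v A = dflt}.Finite) :
    ∃ D : Finset dom, ∀ i w, R i w ≠ 0 → ∀ A ∈ X i, w A ∈ D := by
  have hD : (⋃ i, ⋃ A : V,
      (fun w => w A) '' {v : V → dom | R i v ≠ 0 ∧ ∀ A, A ∉ X i → v A = dflt}).Finite :=
    Set.finite_iUnion fun i => Set.finite_iUnion fun A => (hfin i).image _
  refine ⟨hD.toFinset, fun i w hw A hA => ?_⟩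
  rw [Set.Finite.mem_toFinset]
  refine Set.mem_iUnion₂.2 ⟨i, A, fun B => if B ∈ X i then w B else dflt, ⟨?_, ?_⟩, by simp [hA]⟩
  · rwa [hdep i (x := fun B => if B ∈ X i then w B else dflt) (y := w)
      fun B hB => by simp [hB]]
  · intro B hB
    simp [hB]

/-- The relation that an atom with relation `r` over `X` contributes at a node with bag `Y`:
`r` itself if the node covers the atom, and the indicator of the projection of its support
otherwise. -/
def localFactor (X Y : Set V) (covered : Prop) (r : (V → dom) → K) (w : V → dom) : K :=
  if covered then r w
  else if ∃ x : V → dom, r x ≠ 0 ∧ ∀ A ∈ X ∩ Y, x A = w A then 1 else 0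

lemma dependsOn_localFactor {X Y : Set V} {covered : Prop} {r : (V → dom) → K}
    (hr : DependsOn r X) (hXY : covered → X ⊆ Y) : DependsOn (localFactor X Y covered r) Y := by
  intro w₁ w₂ h
  rw [localFactor, localFactor]
  split_ifs with hc h₁ h₂ h₂
  · exact hr fun A hA => h A (hXY hc hA)
  · rfl
  · obtain ⟨x, hx, hxw⟩ := h₁
    exact absurd ⟨x, hx, fun A hA => (hxw A hA).trans (h A hA.2)⟩ h₂
  · obtain ⟨x, hx, hxw⟩ := h₂
    exact absurd ⟨x, hx, fun A hA => (hxw A hA).trans (h A hA.2).symm⟩ h₁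
  · rfl

lemma mem_of_localFactor_ne_zero {X Y : Set V} {covered : Prop} {r : (V → dom) → K}
    {D : Finset dom} (hD : ∀ w, r w ≠ 0 → ∀ A ∈ X, w A ∈ D) {w : V → dom}
    (hw : localFactor X Y covered r w ≠ 0) {A : V} (hAX : A ∈ X) (hAY : A ∈ Y) : w A ∈ D := by
  rw [localFactor] at hw
  split_ifs at hw with hc h
  · exact hD w hw A hAX
  · obtain ⟨x, hx, hxw⟩ := h
    exact hxw A ⟨hAX, hAY⟩ ▸ hD x hx A hAX
  · exact absurd rfl hw

/-- Multiplying the contributions of an atom over all nodes gives back its relation. -/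
lemma prod_localFactor {ν : Type*} [Fintype ν] (X : Set V) (χ : ν → Set V) (v₀ : ν)
    (r : (V → dom) → K) (w : V → dom) :
    ∏ v, localFactor X (χ v) (v₀ = v) r w = r w := by
  rw [Finset.prod_eq_mul_prod_sdiff_singleton_of_mem (Finset.mem_univ v₀)]
  rw [localFactor, if_pos rfl]
  by_cases hw : r w = 0
  · rw [hw, zero_mul]
  · rw [Finset.prod_eq_one, mul_one]
    intro v hv
    rw [localFactor, if_neg, if_pos ⟨w, hw, fun _ _ => rfl⟩]
    rintro rfl
    simp at hv

end Atoms

end MessagePassing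

end

open MessagePassing

/-- correctness of bottom-up message passing over a tree
decomposition.  A sum-product query `Q(Xout) ← ⊗_i R i (X i)` over a commutative
semiring `K` has variables `V = var(Q)` (every variable occurs in some atom); relations
are represented as functions on total tuples `V → dom` depending only on their
attributes, with finite support.  Let `(root, par, χ)` be a tree decomposition of `Q`
together with a covering choice `cover` of atoms by nodes, and let `M v` be the messages
`⟦Q^v⟧` computed bottom-up: `M v` satisfies the recurrence stating that `M v u` is the
sum, over canonical tuples `w` over `Y^v = χ v` agreeing with `u` on
`Z^v` (`= Xout` for the root and `= χ v ∩ χ (par v)` otherwise), of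
`∏_i R_i^v(w) * ∏_{w' ∈ child(v)} M w' w`, where `R_i^v = R i` if `cover i = v` and
otherwise is the `0/1`-indicator of the projection of `supp (R i)` onto `X i ∩ χ v`.
Then `⟦Q^{root}⟧ = ⟦Q⟧`, i.e. `M root u = ⊕_{w : w[Xout] = u[Xout]} ⊗_i R i w`
for every `u`. -/
theorem stmt_19 {V dom K : Type*} [CommSemiring K] [Fintype V] [DecidableEq V]
    [Infinite dom] (dflt : dom)
    {m : ℕ} (X : Fin m → Set V) (Xout : Set V)
    (R : Fin m → (V → dom) → K)
    (hdep : ∀ (i : Fin m) (v w : V → dom), (∀ A ∈ X i, v A = w A) → R i v = R i w)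
    (hfin : ∀ i, {v : V → dom | R i v ≠ 0 ∧ ∀ A, A ∉ X i → v A = dflt}.Finite)
    (hvar : ∀ A : V, ∃ i, A ∈ X i)
    {ν : Type*} [Fintype ν] (root : ν) (par : ν → ν)
    (hT : par root = root ∧ ∀ v : ν, ∃ n : ℕ, par^[n] v = root)
    (χ : ν → Set V)
    (hTD1 : Xout ⊆ χ root)
    (hTD2 : ∀ (A : V) (v w : ν), A ∈ χ v → A ∈ χ w →
      ∃ t : ν, A ∈ χ t ∧ t ∈ anccP par v ∧ t ∈ anccP par w ∧
        (∀ u : ν, u ∈ anccP par v → t ∈ anccP par u → A ∈ χ u) ∧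
        (∀ u : ν, u ∈ anccP par w → t ∈ anccP par u → A ∈ χ u))
    (cover : Fin m → ν) (hcover : ∀ i, X i ⊆ χ (cover i))
    (M : ν → (V → dom) → K)
    (hM : ∀ (v : ν) (u : V → dom), M v u =
      ∑ᶠ w ∈ {w : V → dom | (∀ A, A ∉ χ v → w A = dflt) ∧
          ∀ A ∈ (if v = root then Xout else χ v ∩ χ (par v)), w A = u A},
        (∏ i : Fin m,
          if cover i = v then R i w
          else if ∃ x : V → dom, R i x ≠ 0 ∧ ∀ A ∈ X i ∩ χ v, x A = w A then (1 : K)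
          else 0) *
        ∏ᶠ w' ∈ {w' : ν | par w' = v ∧ w' ≠ v}, M w' w) :
    ∀ u : V → dom,
      M root u = ∑ᶠ w ∈ {w : V → dom | ∀ A ∈ Xout, w A = u A}, ∏ i : Fin m, R i w := by
  intro u
  obtain ⟨D, hD⟩ := exists_activeDomain dflt (X := X) (R := R) (fun i v w => hdep i v w) hfin
  set F : ν → (V → dom) → K :=
    fun v w => ∏ i, localFactor (X i) (χ v) (cover i = v) (R i) w with hF
  have hFdep : ∀ v, DependsOn (F v) (χ v) := fun v w₁ w₂ h =>
    Finset.prod_congr rfl fun i _ =>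
      dependsOn_localFactor (fun v w => hdep i v w) (fun hc => hc ▸ hcover i) h
  have hFD : ∀ v w, F v w ≠ 0 → ∀ A ∈ χ v, w A ∈ D := by
    intro v w hw A hA
    obtain ⟨i, hi⟩ := hvar A
    exact mem_of_localFactor_ne_zero (hD i)
      (fun h => hw (Finset.prod_eq_zero (Finset.mem_univ i) h)) hi hA
  have hMdep : ∀ v, DependsOn (M v) (interfaceVars root par χ Xout v) := by
    intro v u₁ u₂ h
    rw [hM v u₁, hM v u₂]
    refine finsum_mem_congr ?_ fun _ _ => rfl
    ext w
    refine and_congr_right fun _ => forall₂_congr fun A hA => ?_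
    rw [h A hA]
  have hrec : ∀ v, M v = sumOut D (χ v \ interfaceVars root par χ Xout v)
      (F v * ∏ c ∈ children par v, M c) := by
    intro v
    funext u
    rw [← finsum_eq_sumOut (dflt := dflt) _ _ (interfaceVars_subset hTD1 v), hM v u]
    · refine finsum_mem_congr rfl fun w _ => ?_
      have hch : (children par v : Set ν) = {c | par c = v ∧ c ≠ v} := by simp [children]
      rw [Pi.mul_apply, Finset.prod_apply,
        ← finprod_mem_coe_finset (fun c => M c w) (children par v), hch]
      rfl
    · intro w₁ w₂ h
      rw [Pi.mul_apply, Pi.mul_apply, hFdep v h, Finset.prod_apply, Finset.prod_apply]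
      congr 1
      refine Finset.prod_congr rfl fun c hc => hMdep c fun A hA => h A ?_
      rw [interfaceVars_child hT.1 hc] at hA
      exact hA.2
    · exact fun w hw => hFD v w (left_ne_zero_of_mul hw)
  have hroot : subtree par root = Finset.univ := by
    ext x
    exact iff_of_true (mem_subtree.2 (hT.2 x)) (Finset.mem_univ x)
  have hvars : subtreeVars par χ root = Set.univ := by
    refine Set.eq_univ_of_forall fun A => ?_
    obtain ⟨i, hi⟩ := hvar A
    exact mem_subtreeVars.2 ⟨cover i, hT.2 _, hcover i hi⟩
  have hprod : ∏ x, F x = fun w => ∏ i, R i w := by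
    funext w
    rw [Finset.prod_apply, hF, Finset.prod_comm]
    exact Finset.prod_congr rfl fun i _ => prod_localFactor (X i) χ (cover i) (R i) w
  rw [message_eq_sumOut hT hTD2 hTD1 hFdep hrec root, hroot, hvars, hprod,
    interfaceVars, if_pos rfl, ← finsum_eq_sumOut (dflt := dflt) _ _ (Set.subset_univ Xout)]
  · simp
  · intro w₁ w₂ h
    rw [funext fun A => h A (Set.mem_univ A)]
  · intro w hw A _
    obtain ⟨i, hi⟩ := hvar A
    exact hD i w (fun h => hw (Finset.prod_eq_zero (Finset.mem_univ i) h)) A hi
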